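/- arXiv:1810.01516 — 9 statements merged into one kernel-verified Lean document; each statement's English description precedes it below -/
import Mathlib

section
/- Let p be a real number with 1/2 < p < 1 and let M : ℕ → ℕ → ℝ be a nonnegative matrix with Geom(p) marginals. Then for every k ∈ ℕ the hook L(k) contains a strictly positive entry; that is, there exists i ≤ k such that M(i,k) > 0 or M(k,i) > 0. -/
/-- For `1/2 < p < 1` and a nonnegative matrix `M : ℕ → ℕ → ℝ` with
`Geom(p)` marginals (row and column sums equal to `δ_p(k) = (1-p)^k * p`),
every hook `L(k)` contains a strictly positive entry: there is `i ≤ k` with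
`M i k > 0` or `M k i > 0`. -/
theorem hook_pos_of_geom_marginals (p : ℝ) (hp : 1 / 2 < p) (hp1 : p < 1)
    (M : ℕ → ℕ → ℝ) (hnonneg : ∀ k l, 0 ≤ M k l)
    (hrowSummable : ∀ k, Summable fun l => M k l)
    (hcolSummable : ∀ k, Summable fun l => M l k)
    (hrow : ∀ k, ∑' l, M k l = (1 - p) ^ k * p)
    (hcol : ∀ k, ∑' l, M l k = (1 - p) ^ k * p) :
    ∀ k : ℕ, ∃ i ≤ k, 0 < M i k ∨ 0 < M k i := by
  intro k
  by_contra! h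
  have hzero : ∀ i ∈ Finset.range (k + 1), M i k = 0 := fun i hi =>
    le_antisymm (h i (Nat.lt_succ_iff.mp (Finset.mem_range.mp hi))).1 (hnonneg i k)
  have hle : ∀ i, M i k ≤ (1 - p) ^ i * p := fun i =>
    hrow i ▸ (hrowSummable i).le_tsum k fun l _ => hnonneg i l
  have htail : ∑' i, M (i + (k + 1)) k = (1 - p) ^ k * p := by
    rw [← hcol k, ← (hcolSummable k).sum_add_tsum_nat_add (k + 1),
      Finset.sum_eq_zero hzero, zero_add]
  have hgeom : HasSum (fun i : ℕ => (1 - p) ^ (i + (k + 1)) * p) ((1 - p) ^ (k + 1)) := by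
    have hs := (hasSum_geometric_of_lt_one (r := 1 - p) (by linarith) (by linarith)).mul_left
      ((1 - p) ^ (k + 1) * p)
    have hp0 : p ≠ 0 := by linarith
    rw [sub_sub_cancel, mul_assoc, mul_inv_cancel₀ hp0, mul_one] at hs
    simpa only [pow_add _ _ (k + 1), mul_comm, mul_left_comm] using hs
  have hbound : (1 - p) ^ k * p ≤ (1 - p) ^ (k + 1) := by
    rw [← htail, ← hgeom.tsum_eq]
    exact ((summable_nat_add_iff (k + 1)).mpr (hcolSummable k)).tsum_le_tsum
      (fun i => hle (i + (k + 1))) hgeom.summable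
  have hpos : 0 < (1 - p) ^ k := pow_pos (by linarith) k
  rw [pow_succ] at hbound
  linarith [le_of_mul_le_mul_left hbound hpos]
end

section
/- Let p be a real number with 1/2 ≤ p < 1 and let M : ℕ → ℕ → ℝ be a nonnegative matrix with Geom(p) marginals. Then for every k ∈ ℕ, the partial row sum satisfies ∑_{l=0}^{k} M(k,l) ≥ (1-p)^k · (2p - 1), and likewise ∑_{l=0}^{k} M(l,k) ≥ (1-p)^k · (2p - 1). -/
/-- A row of a nonnegative matrix has at least mass `q ^ k * (2 * p - 1)` up to the diagonal when the
row sums and column sums are `q ^ k * p` with `q = 1 - p`: the mass beyond the diagonal is dominated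
by the geometric tail `q ^ (k + 1)` of the column sums. -/
theorem geometric_row_partial_sum_lower_bound {p : ℝ} (hp : 0 < p) (hp1 : p < 1)
    {M : ℕ → ℕ → ℝ} (hnonneg : ∀ k l, 0 ≤ M k l)
    (hrowSummable : ∀ k, Summable fun l => M k l)
    (hcolSummable : ∀ k, Summable fun l => M l k)
    (hrow : ∀ k, ∑' l, M k l = (1 - p) ^ k * p)
    (hcol : ∀ k, ∑' l, M l k = (1 - p) ^ k * p) (k : ℕ) :
    (1 - p) ^ k * (2 * p - 1) ≤ ∑ l ∈ Finset.range (k + 1), M k l := by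
  have entry_le (l : ℕ) : M k l ≤ (1 - p) ^ l * p :=
    hcol l ▸ (hcolSummable l).le_tsum k fun j _ => hnonneg j l
  have tail_hasSum : HasSum (fun l => (1 - p) ^ (l + (k + 1)) * p) ((1 - p) ^ (k + 1)) := by
    have h := (hasSum_geometric_of_lt_one (sub_nonneg.2 hp1.le) (sub_lt_self 1 hp)).mul_right
      ((1 - p) ^ (k + 1) * p)
    convert! h using 1
    · funext l
      ring
    · rw [sub_sub_cancel]
      field_simp
  have tail_le : ∑' l, M k (l + (k + 1)) ≤ (1 - p) ^ (k + 1) :=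
    tail_hasSum.tsum_eq ▸ ((summable_nat_add_iff (k + 1)).2 (hrowSummable k)).tsum_le_tsum
      (fun l => entry_le (l + (k + 1))) tail_hasSum.summable
  have split := (hrowSummable k).sum_add_tsum_nat_add (k + 1)
  rw [hrow k] at split
  rw [pow_succ] at tail_le
  linarith

/-- For `1/2 ≤ p < 1` and a nonnegative matrix `M : ℕ → ℕ → ℝ` with
`Geom(p)` marginals, for every `k` the partial row sum satisfies
`∑_{l=0}^{k} M k l ≥ (1-p)^k * (2p - 1)`, and likewise for columns. -/
theorem partial_hook_sum_lower_bound (p : ℝ) (hp : 1 / 2 ≤ p) (hp1 : p < 1)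
    (M : ℕ → ℕ → ℝ) (hnonneg : ∀ k l, 0 ≤ M k l)
    (hrowSummable : ∀ k, Summable fun l => M k l)
    (hcolSummable : ∀ k, Summable fun l => M l k)
    (hrow : ∀ k, ∑' l, M k l = (1 - p) ^ k * p)
    (hcol : ∀ k, ∑' l, M l k = (1 - p) ^ k * p) :
    ∀ k : ℕ, (1 - p) ^ k * (2 * p - 1) ≤ ∑ l ∈ Finset.range (k + 1), M k l ∧
      (1 - p) ^ k * (2 * p - 1) ≤ ∑ l ∈ Finset.range (k + 1), M l k := by
  have hp0 : 0 < p := by linarith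
  exact fun k =>
    ⟨geometric_row_partial_sum_lower_bound hp0 hp1 hnonneg hrowSummable hcolSummable hrow hcol k,
      geometric_row_partial_sum_lower_bound (M := fun k l => M l k) hp0 hp1
        (fun k l => hnonneg l k) hcolSummable hrowSummable hcol hrow k⟩
end

section
/- Let δ : ℕ → ℝ be a nonnegative summable function such that δ(i) > ∑_{j > i} δ(j) for every i ∈ ℕ, and let M : ℕ → ℕ → ℝ be a nonnegative matrix such that for every k ∈ ℕ the families (M(k,l))_{l∈ℕ} and (M(l,k))_{l∈ℕ} are summable with ∑_{l∈ℕ} M(k,l) = δ(k) and ∑_{l∈ℕ} M(l,k) = δ(k). Then for every k ∈ ℕ there exists i ≤ k such that M(i,k) > 0 or M(k,i) > 0. -/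
/-- Let `δ : ℕ → ℝ` be nonnegative, summable, with
`δ i > ∑_{j > i} δ j` for every `i`, and let `M` be a nonnegative matrix whose
row and column sums both equal `δ`. Then for every `k` there is `i ≤ k` with
`M i k > 0` or `M k i > 0`. -/
theorem hook_pos_of_heavy_head_marginals (δ : ℕ → ℝ)
    (hδnonneg : ∀ i, 0 ≤ δ i) (hδsummable : Summable δ)
    (hhead : ∀ i : ℕ, (∑' j : {j : ℕ // i < j}, δ (j : ℕ)) < δ i)
    (M : ℕ → ℕ → ℝ) (hnonneg : ∀ k l, 0 ≤ M k l)
    (hrowSummable : ∀ k, Summable fun l => M k l)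
    (hcolSummable : ∀ k, Summable fun l => M l k)
    (hrow : ∀ k, ∑' l, M k l = δ k)
    (hcol : ∀ k, ∑' l, M l k = δ k) :
    ∀ k : ℕ, ∃ i ≤ k, 0 < M i k ∨ 0 < M k i := by
  intro k
  by_contra! h
  have hzero : ∀ i ≤ k, M i k = 0 := fun i hi => le_antisymm (h i hi).1 (hnonneg i k)
  have htail : ∑' l : {l : ℕ // k < l}, M l k = ∑' l, M l k := by
    refine tsum_subtype_eq_of_support_subset (f := fun l => M l k) (s := {l | k < l}) fun l hl => ?_
    by_contra hkl
    exact hl (hzero l (not_lt.mp hkl))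
  have hle : ∑' l : {l : ℕ // k < l}, M l k ≤ ∑' l : {l : ℕ // k < l}, δ l := by
    refine Summable.tsum_le_tsum (fun l => ?_)
      ((hcolSummable k).subtype {l | k < l}) (hδsummable.subtype {l | k < l})
    rw [← hrow l]
    exact (hrowSummable l).le_tsum k fun j _ => hnonneg l j
  linarith [hhead k, hcol k]
end

section
/- Let M : ℕ → ℕ → ℝ be a nonnegative matrix with Geom(1/2) marginals. Then there exists at most one k ∈ ℕ such that all entries of the hook L(k) are zero; that is, if all entries of L(k) are zero and all entries of L(k') are zero, then k = k'. -/
/-- If the entries of row `k` are bounded by the `Geom(1/2)` weights and its first `k + 1` entries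
vanish, then it cannot have the `Geom(1/2)` mass of `k` and another zero beyond `k`: the weights
beyond `k` sum to exactly the weight of `k`. -/
lemma tsum_lt_geom_of_zero_beyond (f : ℕ → ℝ) (hf : Summable f) (k k' : ℕ) (hkk' : k < k')
    (hle : ∀ j, f j ≤ (1 - 1 / 2 : ℝ) ^ j * (1 / 2))
    (hzero : ∀ j ≤ k, f j = 0) (hk' : f k' = 0) :
    ∑' j, f j < (1 - 1 / 2 : ℝ) ^ k * (1 / 2) := by
  have tail : HasSum (fun j => (1 - 1 / 2 : ℝ) ^ (j + (k + 1)) * (1 / 2))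
      ((1 - 1 / 2 : ℝ) ^ k * (1 / 2)) := by
    have h := hasSum_geometric_two.mul_left ((1 - 1 / 2 : ℝ) ^ (k + 1) * (1 / 2))
    have hsum : (1 - 1 / 2 : ℝ) ^ (k + 1) * (1 / 2) * 2 = (1 - 1 / 2 : ℝ) ^ k * (1 / 2) := by
      ring
    rw [hsum] at h
    refine (congrArg (HasSum · _) (funext fun j => ?_)).mp h
    ring
  rw [← hf.sum_add_tsum_nat_add (k + 1), ← tail.tsum_eq,
    Finset.sum_eq_zero fun j hj => hzero j (by simpa [Nat.lt_succ_iff] using hj), zero_add]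
  refine Summable.tsum_lt_tsum (i := k' - (k + 1)) (fun j => hle _) ?_
    ((summable_nat_add_iff (k + 1)).2 hf) tail.summable
  rw [Nat.sub_add_cancel hkk', hk']
  norm_num

/-- For a nonnegative matrix `M : ℕ → ℕ → ℝ` with `Geom(1/2)` marginals
(`δ_{1/2}(k) = (1 - 1/2)^k * (1/2)`), there is at most one `k` whose hook `L(k)`
consists entirely of zeros. -/
theorem at_most_one_zero_hook (M : ℕ → ℕ → ℝ) (hnonneg : ∀ k l, 0 ≤ M k l)
    (hrowSummable : ∀ k, Summable fun l => M k l)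
    (hcolSummable : ∀ k, Summable fun l => M l k)
    (hrow : ∀ k, ∑' l, M k l = (1 - 1 / 2 : ℝ) ^ k * (1 / 2))
    (hcol : ∀ k, ∑' l, M l k = (1 - 1 / 2 : ℝ) ^ k * (1 / 2))
    (k k' : ℕ)
    (hk : ∀ i ≤ k, M i k = 0 ∧ M k i = 0)
    (hk' : ∀ i ≤ k', M i k' = 0 ∧ M k' i = 0) :
    k = k' := by
  have key : ∀ a b : ℕ, (∀ i ≤ a, M a i = 0) → (∀ i ≤ b, M i b = 0) → ¬ a < b := by
    intro a b ha hb hab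
    refine (tsum_lt_geom_of_zero_beyond (M a) (hrowSummable a) a b hab (fun j => ?_) ha
      (hb a hab.le)).ne (hrow a)
    rw [← hcol j]
    exact (hcolSummable j).le_tsum a fun i _ => hnonneg i j
  exact le_antisymm
    (not_lt.1 (key k' k (fun i hi => (hk' i hi).2) fun i hi => (hk i hi).1))
    (not_lt.1 (key k k' (fun i hi => (hk i hi).2) fun i hi => (hk' i hi).1))
end

section
/- Let M : ℕ → ℕ → ℝ be a nonnegative matrix with Geom(1/2) marginals, and let k ∈ ℕ be such that all entries of the hook L(k) are zero (i.e., M(i,k) = 0 and M(k,i) = 0 for all i ≤ k). Then for every m > k it holds that M(k,m) = 2^{-(m+1)} and M(m,k) = 2^{-(m+1)}. -/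
/-- A summable real sequence that vanishes up to index `k`, is dominated by `(1/2)^(m+1)`, and
has the same sum as the tail of `(1/2)^(m+1)` beyond `k`, agrees with `(1/2)^(m+1)` beyond `k`. -/
theorem eq_half_pow_of_le_of_tsum_eq {f : ℕ → ℝ} {k : ℕ} (hf : Summable f)
    (hzero : ∀ i ≤ k, f i = 0) (hle : ∀ m, f m ≤ (1 / 2 : ℝ) ^ (m + 1))
    (hsum : ∑' i, f i = (1 / 2 : ℝ) ^ (k + 1)) {m : ℕ} (hm : k < m) :
    f m = (1 / 2 : ℝ) ^ (m + 1) := by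
  have htail : HasSum (fun i => f (i + (k + 1))) ((1 / 2 : ℝ) ^ (k + 1)) := by
    rw [hasSum_nat_add_iff, Finset.sum_eq_zero fun i hi =>
      hzero i (Nat.lt_succ_iff.mp (Finset.mem_range.mp hi)), add_zero, ← hsum]
    exact hf.hasSum
  have hgeom : HasSum (fun i : ℕ => (1 / 2 : ℝ) ^ (i + (k + 1) + 1)) ((1 / 2 : ℝ) ^ (k + 1)) := by
    have h := hasSum_geometric_two.mul_left ((1 / 2 : ℝ) ^ (k + 2))
    rw [show (1 / 2 : ℝ) ^ (k + 2) * 2 = (1 / 2) ^ (k + 1) by ring] at h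
    refine (congrArg (HasSum · _) (funext fun i => ?_)).mp h
    ring
  have hdiff := hgeom.sub htail
  rw [sub_self, hasSum_zero_iff_of_nonneg fun i => sub_nonneg.mpr (hle _)] at hdiff
  have h := congrFun hdiff (m - (k + 1))
  simp only [Nat.sub_add_cancel (Nat.succ_le_of_lt hm), Pi.zero_apply] at h
  exact (sub_eq_zero.mp h).symm


/-- For a nonnegative matrix `M : ℕ → ℕ → ℝ` with `Geom(1/2)` marginals,
if all entries of the hook `L(k)` are zero, then for every `m > k` one has
`M k m = 2^{-(m+1)}` and `M m k = 2^{-(m+1)}`. -/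
theorem zero_hook_determines_tail (M : ℕ → ℕ → ℝ) (hnonneg : ∀ k l, 0 ≤ M k l)
    (hrowSummable : ∀ k, Summable fun l => M k l)
    (hcolSummable : ∀ k, Summable fun l => M l k)
    (hrow : ∀ k, ∑' l, M k l = (1 - 1 / 2 : ℝ) ^ k * (1 / 2))
    (hcol : ∀ k, ∑' l, M l k = (1 - 1 / 2 : ℝ) ^ k * (1 / 2))
    (k : ℕ) (hk : ∀ i ≤ k, M i k = 0 ∧ M k i = 0) :
    ∀ m : ℕ, k < m → M k m = (1 / 2 : ℝ) ^ (m + 1) ∧ M m k = (1 / 2 : ℝ) ^ (m + 1) := by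
  have hgeom (n : ℕ) : (1 - 1 / 2 : ℝ) ^ n * (1 / 2) = (1 / 2 : ℝ) ^ (n + 1) := by
    norm_num [pow_succ]
  simp only [hgeom] at hrow hcol
  intro m hm
  constructor
  · refine eq_half_pow_of_le_of_tsum_eq (hrowSummable k) (fun i hi => (hk i hi).2)
      (fun n => ?_) (hrow k) hm
    exact (hcol n).symm ▸ (hcolSummable n).le_tsum k fun l _ => hnonneg l n
  · refine eq_half_pow_of_le_of_tsum_eq (hcolSummable k) (fun i hi => (hk i hi).1)
      (fun n => ?_) (hcol k) hm
    exact (hrow n).symm ▸ (hrowSummable n).le_tsum k fun l _ => hnonneg n l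
end

section
/- Let M : ℕ → ℕ → ℝ be a nonnegative matrix with Geom(1/2) marginals, and let k ∈ ℕ be such that all entries of the hook L(k) are zero. Then for every m > k the hook L(m) contains at least two strictly positive entries; in particular M(k,m) > 0 and M(m,k) > 0. -/
/-- A sequence dominated by the `Geom(1/2)` weights, vanishing on `[0, k]` and of total mass
`(1/2)^k * (1/2)`, is positive beyond `k`: the mass of the weights beyond `k` is exactly that. -/
theorem pos_of_tsum_eq_geometric_tail {f : ℕ → ℝ} {k : ℕ} (hf : Summable f)
    (hle : ∀ i, f i ≤ (1 - 1 / 2 : ℝ) ^ i * (1 / 2)) (hzero : ∀ i ≤ k, f i = 0)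
    (hsum : ∑' i, f i = (1 - 1 / 2 : ℝ) ^ k * (1 / 2)) {m : ℕ} (hm : k < m) : 0 < f m := by
  by_contra! hneg
  have hsplit := hf.sum_add_tsum_nat_add (k + 1)
  rw [Finset.sum_eq_zero fun i hi => hzero i (Finset.mem_range_succ_iff.mp hi), zero_add, hsum]
    at hsplit
  have htail : HasSum (fun n : ℕ => (1 - 1 / 2 : ℝ) ^ (n + (k + 1)) * (1 / 2))
      ((1 - 1 / 2 : ℝ) ^ k * (1 / 2)) := by
    have hmass : (1 - 1 / 2 : ℝ) ^ k * (1 / 2) = 2 * ((1 / 2 : ℝ) ^ (k + 1) * (1 / 2)) := by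
      norm_num
      ring
    rw [hmass]
    have hweights : (fun n : ℕ => (1 - 1 / 2 : ℝ) ^ (n + (k + 1)) * (1 / 2)) =
        fun n => (1 / 2 : ℝ) ^ n * ((1 / 2 : ℝ) ^ (k + 1) * (1 / 2)) := by
      funext n
      rw [pow_add, mul_assoc]
      norm_num
    rw [hweights]
    exact hasSum_geometric_two.mul_right _
  have hlt := Summable.tsum_lt_tsum (i := m - (k + 1)) (fun n => hle (n + (k + 1)))
    (by
      rw [Nat.sub_add_cancel hm]
      exact hneg.trans_lt (by positivity))
    ((summable_nat_add_iff (k + 1)).mpr hf) htail.summable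
  rw [htail.tsum_eq, hsplit] at hlt
  exact lt_irrefl _ hlt

/-- For a nonnegative matrix `M : ℕ → ℕ → ℝ` with `Geom(1/2)` marginals,
if all entries of the hook `L(k)` are zero, then for every `m > k` the hook `L(m)`
contains at least two strictly positive entries; in particular `M k m > 0` and
`M m k > 0`. The hook `L(m)` consists of the positions `(i, m)` for `i ≤ m` and
`(m, j)` for `j ≤ m`. -/
theorem zero_hook_later_hooks_two_pos (M : ℕ → ℕ → ℝ) (hnonneg : ∀ k l, 0 ≤ M k l)
    (hrowSummable : ∀ k, Summable fun l => M k l)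
    (hcolSummable : ∀ k, Summable fun l => M l k)
    (hrow : ∀ k, ∑' l, M k l = (1 - 1 / 2 : ℝ) ^ k * (1 / 2))
    (hcol : ∀ k, ∑' l, M l k = (1 - 1 / 2 : ℝ) ^ k * (1 / 2))
    (k : ℕ) (hk : ∀ i ≤ k, M i k = 0 ∧ M k i = 0) :
    ∀ m : ℕ, k < m →
      (∃ q₁ q₂ : ℕ × ℕ, q₁ ≠ q₂ ∧
        ((q₁.2 = m ∧ q₁.1 ≤ m) ∨ (q₁.1 = m ∧ q₁.2 ≤ m)) ∧
        ((q₂.2 = m ∧ q₂.1 ≤ m) ∨ (q₂.1 = m ∧ q₂.2 ≤ m)) ∧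
        0 < M q₁.1 q₁.2 ∧ 0 < M q₂.1 q₂.2) ∧
      0 < M k m ∧ 0 < M m k := by
  intro m hm
  have hkm : 0 < M k m := pos_of_tsum_eq_geometric_tail (hrowSummable k)
    (fun j => hcol j ▸ (hcolSummable j).le_tsum k fun i _ => hnonneg i j)
    (fun i hi => (hk i hi).2) (hrow k) hm
  have hmk : 0 < M m k := pos_of_tsum_eq_geometric_tail (hcolSummable k)
    (fun j => hrow j ▸ (hrowSummable j).le_tsum k fun i _ => hnonneg j i)
    (fun i hi => (hk i hi).1) (hcol k) hm
  refine ⟨⟨(k, m), (m, k), ?_, Or.inl ⟨rfl, hm.le⟩, Or.inr ⟨rfl, hm.le⟩, hkm, hmk⟩, hkm, hmk⟩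
  exact fun h => hm.ne (congrArg Prod.fst h)
end

section
/- Let M : ℕ → ℕ → ℝ be a matrix all of whose rows and columns are summable, let ε ∈ ℝ, let ℓ ∈ ℕ, let h ∈ ℕ, and let p_0, p_1, …, p_{2h+2} be pairwise distinct positions in ℕ × ℕ such that: p_0 = (i, ℓ) and p_{2h+2} = (ℓ, j) for some i, j ∈ ℕ; for every t ≤ h, the positions p_{2t} and p_{2t+1} have the same first coordinate; for every t ≤ h, the positions p_{2t+1} and p_{2t+2} have the same second coordinate; the first coordinate of p_s is different from ℓ for all s ≤ 2h+1; and the second coordinate of p_s is different from ℓ for all s ≥ 1. Define M' : ℕ → ℕ → ℝ by M'(x) = M(x) + ε if x = p_{2t} for some t ≤ h+1, M'(x) = M(x) − ε if x = p_{2t+1} for some t ≤ h, and M'(x) = M(x) otherwise. Then for every n ≠ ℓ, ∑_{m∈ℕ} M'(n,m) = ∑_{m∈ℕ} M(n,m) and ∑_{m∈ℕ} M'(m,n) = ∑_{m∈ℕ} M(m,n), while ∑_{m∈ℕ} M'(ℓ,m) = ∑_{m∈ℕ} M(ℓ,m) + ε and ∑_{m∈ℕ} M'(m,ℓ) = ∑_{m∈ℕ}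 M(m,ℓ) + ε. -/
open Finset in
/-- An alternating sum of odd length whose consecutive pairs `2 * t, 2 * t + 1` agree reduces to
its last term. -/
theorem sum_range_alternating_eq_last (f : ℕ → ℝ) (h : ℕ)
    (hf : ∀ t ≤ h, f (2 * t) = f (2 * t + 1)) :
    ∑ s ∈ range (2 * h + 3), (-1) ^ s * f s = f (2 * h + 2) := by
  induction h with
  | zero => simp [sum_range_succ, hf 0 le_rfl]
  | succ k ih =>
    have hk := hf (k + 1) le_rfl
    rw [show 2 * (k + 1) + 3 = 2 * k + 3 + 1 + 1 by ring, sum_range_succ, sum_range_succ,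
      ih fun t ht => hf t (by omega)]
    simp only [mul_add, mul_one] at hk ⊢
    have h1 : (-1 : ℝ) ^ (2 * k + 3) = -1 := Odd.neg_one_pow ⟨k + 1, by ring⟩
    have h2 : (-1 : ℝ) ^ (2 * k + 3 + 1) = 1 := Even.neg_one_pow ⟨k + 2, by ring⟩
    rw [h1, h2, hk]
    ring

open Finset in
/-- An alternating sum of odd length whose consecutive pairs `2 * t + 1, 2 * t + 2` agree reduces to
its first term. -/
theorem sum_range_alternating_eq_first (f : ℕ → ℝ) (h : ℕ)
    (hf : ∀ t ≤ h, f (2 * t + 1) = f (2 * t + 2)) :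
    ∑ s ∈ range (2 * h + 3), (-1) ^ s * f s = f 0 := by
  have hr := sum_range_alternating_eq_last (fun s => f (2 * h + 2 - s)) h fun t ht => by
    have := hf (h - t) (by omega)
    rw [show 2 * h + 2 - 2 * t = 2 * (h - t) + 2 by omega,
      show 2 * h + 2 - (2 * t + 1) = 2 * (h - t) + 1 by omega, this]
  rw [← sum_range_reflect]
  simp only [Nat.sub_self] at hr
  rw [← hr]
  refine sum_congr rfl fun s hs => ?_
  have hs' : s ≤ 2 * h + 2 := by have := mem_range.1 hs; omega
  rw [show 2 * h + 3 - 1 - s = 2 * h + 2 - s by omega]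
  congr 1
  rw [neg_one_pow_eq_pow_mod_two, neg_one_pow_eq_pow_mod_two (n := s)]
  congr 1
  omega

/-- Adding finitely many point masses `c s` at `a s` to a summable family, keeping only those
with `P s`, adds the retained masses to its sum. -/
theorem tsum_add_sum_ite {ι α : Type*} [DecidableEq α] {g : α → ℝ} (hg : Summable g)
    (S : Finset ι) (c : ι → ℝ) (a : ι → α) (P : ι → Prop) [DecidablePred P] :
    ∑' m, (g m + ∑ s ∈ S, c s * if P s ∧ a s = m then 1 else 0)
      = ∑' m, g m + ∑ s ∈ S, c s * if P s then 1 else 0 := by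
  refine (hg.hasSum.add (hasSum_sum fun s _ => HasSum.mul_left (c s) ?_)).tsum_eq
  by_cases hP : P s
  · simpa [hP, eq_comm] using hasSum_ite_eq (a s) (1 : ℝ)
  · simp [hP]

/-- Perturbing a matrix `M` along an odd chain of pairwise distinct
positions `p 0 = (i, ℓ), p 1, …, p (2h+2) = (ℓ, j)` — adding `ε` at the
even-indexed positions and subtracting `ε` at the odd-indexed positions — leaves
all row and column sums unchanged except the row `ℓ` and the column `ℓ`, whose
sums both increase by `ε`. -/
theorem chain_perturbation_sums (M : ℕ → ℕ → ℝ)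
    (hrowSummable : ∀ n, Summable fun m => M n m)
    (hcolSummable : ∀ n, Summable fun m => M m n)
    (ε : ℝ) (ℓ h i j : ℕ) (p : ℕ → ℕ × ℕ)
    (hinj : ∀ s ≤ 2 * h + 2, ∀ s' ≤ 2 * h + 2, p s = p s' → s = s')
    (hstart : p 0 = (i, ℓ)) (hend : p (2 * h + 2) = (ℓ, j))
    (hfst : ∀ t ≤ h, (p (2 * t)).1 = (p (2 * t + 1)).1)
    (hsnd : ∀ t ≤ h, (p (2 * t + 1)).2 = (p (2 * t + 2)).2)
    (hfst_ne : ∀ s ≤ 2 * h + 1, (p s).1 ≠ ℓ)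
    (hsnd_ne : ∀ s, 1 ≤ s → s ≤ 2 * h + 2 → (p s).2 ≠ ℓ)
    (M' : ℕ → ℕ → ℝ)
    (hM'add : ∀ t ≤ h + 1, M' (p (2 * t)).1 (p (2 * t)).2
        = M (p (2 * t)).1 (p (2 * t)).2 + ε)
    (hM'sub : ∀ t ≤ h, M' (p (2 * t + 1)).1 (p (2 * t + 1)).2
        = M (p (2 * t + 1)).1 (p (2 * t + 1)).2 - ε)
    (hM'eq : ∀ x : ℕ × ℕ, (∀ s ≤ 2 * h + 2, x ≠ p s) → M' x.1 x.2 = M x.1 x.2) :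
    (∀ n : ℕ, n ≠ ℓ →
        (∑' m, M' n m = ∑' m, M n m) ∧ (∑' m, M' m n = ∑' m, M m n)) ∧
    (∑' m, M' ℓ m = (∑' m, M ℓ m) + ε) ∧
    (∑' m, M' m ℓ = (∑' m, M m ℓ) + ε) := by
  have key : ∀ n m, M' n m = M n m + ∑ s ∈ Finset.range (2 * h + 3),
      ε * (-1) ^ s * if (p s).1 = n ∧ (p s).2 = m then 1 else 0 := by
    intro n m
    by_cases hx : ∃ s ≤ 2 * h + 2, p s = (n, m)
    · obtain ⟨s, hs, hps⟩ := hx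
      rw [Finset.sum_eq_single_of_mem s (Finset.mem_range.2 (by omega))]
      · rcases Nat.even_or_odd' s with ⟨t, rfl | rfl⟩
        · have := hM'add t (by omega)
          simpa [hps] using this
        · have := hM'sub t (by omega)
          simpa [hps, pow_succ, sub_eq_add_neg] using this
      · intro b hb hbs
        have hne : ¬((p b).1 = n ∧ (p b).2 = m) := fun hh =>
          hbs (hinj b (by have := Finset.mem_range.1 hb; omega) s hs
            ((Prod.ext hh.1 hh.2 : p b = (n, m)).trans hps.symm))
        simp [hne]
    · push Not at hx
      rw [Finset.sum_eq_zero, add_zero]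
      · exact hM'eq (n, m) fun s hs => (hx s hs).symm
      · intro b hb
        have hne : ¬((p b).1 = n ∧ (p b).2 = m) := fun hh =>
          hx b (by have := Finset.mem_range.1 hb; omega) (Prod.ext hh.1 hh.2)
        simp [hne]
  have hrow : ∀ n, ∑' m, M' n m = ∑' m, M n m + ε * if ℓ = n then 1 else 0 := by
    intro n
    simp only [key]
    rw [tsum_add_sum_ite (hrowSummable n) _ _ (fun s => (p s).2) fun s => (p s).1 = n]
    simp only [mul_assoc, ← Finset.mul_sum]
    rw [sum_range_alternating_eq_last (fun s => if (p s).1 = n then (1 : ℝ) else 0) h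
      fun t ht => by simp only [hfst t ht], hend]
  have hcol : ∀ n, ∑' m, M' m n = ∑' m, M m n + ε * if ℓ = n then 1 else 0 := by
    intro n
    simp only [key, and_comm (b := (p _).2 = n)]
    rw [tsum_add_sum_ite (hcolSummable n) _ _ (fun s => (p s).1) fun s => (p s).2 = n]
    simp only [mul_assoc, ← Finset.mul_sum]
    rw [sum_range_alternating_eq_first (fun s => if (p s).2 = n then (1 : ℝ) else 0) h
      fun t ht => by simp only [hsnd t ht], hstart]
  refine ⟨fun n hn => ⟨?_, ?_⟩, ?_, ?_⟩
  · simp [hrow, hn.symm]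
  · simp [hcol, hn.symm]
  · simp [hrow]
  · simp [hcol]
end

section
/- Define M : ℕ → ℕ → ℝ by M(0,m) = M(m,0) = 2^{-(m+1)} for every m ≥ 1, and M(k,l) = 0 for all other pairs (k,l) (in particular M(k,k) = 0 for every k). Then M is nonnegative, vanishes on the diagonal, and has Geom(1/2) marginals: for every k ∈ ℕ, ∑_{l∈ℕ} M(k,l) = 2^{-(k+1)} and ∑_{l∈ℕ} M(l,k) = 2^{-(k+1)}. -/
/-- The matrix with `M 0 m = M m 0 = 2^{-(m+1)}` for `m ≥ 1` and all other
entries (including the whole diagonal) equal to `0`. -/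
noncomputable def borderMatrix : ℕ → ℕ → ℝ := fun k l =>
  if k = 0 ∧ 1 ≤ l then (1 / 2 : ℝ) ^ (l + 1)
  else if l = 0 ∧ 1 ≤ k then (1 / 2 : ℝ) ^ (k + 1)
  else 0

theorem borderMatrix_comm (k l : ℕ) : borderMatrix k l = borderMatrix l k := by
  unfold borderMatrix
  split_ifs <;> first | rfl | omega

theorem hasSum_borderMatrix (k : ℕ) :
    HasSum (fun l => borderMatrix k l) ((1 / 2 : ℝ) ^ (k + 1)) := by
  rcases Nat.eq_zero_or_pos k with rfl | hk
  · have hs : HasSum (fun l => borderMatrix 0 (l + 1)) (1 / 2 : ℝ) := by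
      have hg := hasSum_geometric_two.mul_left (1 / 4 : ℝ)
      have hf : (fun l => borderMatrix 0 (l + 1)) = fun l => (1 / 4 : ℝ) * (1 / 2) ^ l := by
        funext l
        simp only [borderMatrix, true_and, Nat.le_add_left, if_true]
        ring
      rw [hf]
      norm_num at hg ⊢
      exact hg
    have hz := (hasSum_nat_add_iff (f := fun l => borderMatrix 0 l) 1).mp hs
    simpa [borderMatrix] using hz
  · have hs := hasSum_single (f := fun l => borderMatrix k l) 0 (fun l hl => by
      simp [borderMatrix, hk.ne', hl])
    have h0 : borderMatrix k 0 = (1 / 2 : ℝ) ^ (k + 1) := by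
      simp [borderMatrix, Nat.one_le_iff_ne_zero, hk.ne']
    rwa [h0] at hs

/-- `borderMatrix` is nonnegative, vanishes on the diagonal, and has
`Geom(1/2)` marginals: every row sum and every column sum equals `2^{-(k+1)}`. -/
theorem borderMatrix_geom_half_marginals :
    (∀ k l, 0 ≤ borderMatrix k l) ∧
    (∀ k, borderMatrix k k = 0) ∧
    (∀ k, Summable fun l => borderMatrix k l) ∧
    (∀ k, Summable fun l => borderMatrix l k) ∧
    (∀ k, ∑' l, borderMatrix k l = (1 / 2 : ℝ) ^ (k + 1)) ∧
    (∀ k, ∑' l, borderMatrix l k = (1 / 2 : ℝ) ^ (k + 1)) := by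
  have hcol (k : ℕ) : HasSum (fun l => borderMatrix l k) ((1 / 2 : ℝ) ^ (k + 1)) := by
    simpa only [borderMatrix_comm k] using hasSum_borderMatrix k
  refine ⟨fun k l => ?_, fun k => ?_, fun k => (hasSum_borderMatrix k).summable,
    fun k => (hcol k).summable, fun k => (hasSum_borderMatrix k).tsum_eq,
    fun k => (hcol k).tsum_eq⟩
  · unfold borderMatrix
    split_ifs <;> positivity
  · unfold borderMatrix
    split_ifs <;> first | rfl | omega
end

section
/- Let S = {(0,k) : k ∈ ℕ} ∪ {(1,k) : k ≥ 1} ∪ {(k,0) : k ≥ 2} ⊆ ℕ × ℕ. Define M : ℕ → ℕ → ℝ by M(0,0) = 1/4, M(1,1) = 1/4, M(0,k) = M(k,0) = 2^{-(k+1)} for every k ≥ 2, and M(k,l) = 0 for all other pairs (k,l). Then M is nonnegative, vanishes outside S, and has Geom(1/2) marginals: for every k ∈ ℕ, ∑_{l∈ℕ} M(k,l) = 2^{-(k+1)} and ∑_{l∈ℕ} M(l,k) = 2^{-(k+1)}. -/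
/-- The matrix with `M 0 0 = 1/4`, `M 1 1 = 1/4`, `M 0 k = M k 0 = 2^{-(k+1)}`
for `k ≥ 2`, and all other entries `0`. -/
noncomputable def exampleMatrix : ℕ → ℕ → ℝ := fun k l =>
  if k = 0 ∧ l = 0 then 1 / 4
  else if k = 1 ∧ l = 1 then 1 / 4
  else if k = 0 ∧ 2 ≤ l then (1 / 2 : ℝ) ^ (l + 1)
  else if l = 0 ∧ 2 ≤ k then (1 / 2 : ℝ) ^ (k + 1)
  else 0

theorem exampleMatrix_comm (k l : ℕ) : exampleMatrix k l = exampleMatrix l k := by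
  unfold exampleMatrix
  split_ifs <;> first | rfl | omega

theorem exampleMatrix_nonneg (k l : ℕ) : 0 ≤ exampleMatrix k l := by
  unfold exampleMatrix
  split_ifs <;> positivity

theorem hasSum_exampleMatrix_zero : HasSum (exampleMatrix 0) (1 / 2) := by
  rw [← hasSum_nat_add_iff' 2]
  have htail : (fun n => exampleMatrix 0 (n + 2)) = fun n => 1 / 8 * (1 / 2 : ℝ) ^ n := by
    funext n
    simp [exampleMatrix]
    ring
  have hsum : 1 / 2 - ∑ i ∈ Finset.range 2, exampleMatrix 0 i = 1 / 8 * 2 := by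
    norm_num [exampleMatrix, Finset.sum_range_succ]
  rw [htail, hsum]
  exact hasSum_geometric_two.mul_left (1 / 8 : ℝ)

theorem hasSum_exampleMatrix (k : ℕ) : HasSum (exampleMatrix k) ((1 / 2 : ℝ) ^ (k + 1)) := by
  match k with
  | 0 => simpa using hasSum_exampleMatrix_zero
  | 1 =>
    convert hasSum_single (f := exampleMatrix 1) 1 ?_ using 1
    · norm_num [exampleMatrix]
    · intro l hl
      simp [exampleMatrix, hl]
  | k + 2 =>
    convert hasSum_single (f := exampleMatrix (k + 2)) 0 ?_ using 1
    · simp [exampleMatrix]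
    · intro l hl
      simp [exampleMatrix, hl]

/-- `exampleMatrix` is nonnegative, vanishes outside
`S = {(0,k) : k ∈ ℕ} ∪ {(1,k) : k ≥ 1} ∪ {(k,0) : k ≥ 2}`, and has `Geom(1/2)`
marginals: every row and column sum equals `2^{-(k+1)}`. -/
theorem exampleMatrix_geom_half_marginals :
    (∀ k l, 0 ≤ exampleMatrix k l) ∧
    (∀ k l : ℕ, ¬ (k = 0 ∨ (k = 1 ∧ 1 ≤ l) ∨ (l = 0 ∧ 2 ≤ k)) → exampleMatrix k l = 0) ∧
    (∀ k, Summable fun l => exampleMatrix k l) ∧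
    (∀ k, Summable fun l => exampleMatrix l k) ∧
    (∀ k, ∑' l, exampleMatrix k l = (1 / 2 : ℝ) ^ (k + 1)) ∧
    (∀ k, ∑' l, exampleMatrix l k = (1 / 2 : ℝ) ^ (k + 1)) := by
  have hcol (k : ℕ) : HasSum (fun l => exampleMatrix l k) ((1 / 2 : ℝ) ^ (k + 1)) := by
    simpa only [exampleMatrix_comm _ k] using hasSum_exampleMatrix k
  refine ⟨exampleMatrix_nonneg, fun k l h => ?_, fun k => (hasSum_exampleMatrix k).summable,
    fun k => (hcol k).summable, fun k => (hasSum_exampleMatrix k).tsum_eq,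
    fun k => (hcol k).tsum_eq⟩
  unfold exampleMatrix
  split_ifs <;> first | rfl | omega
end
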